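/- arXiv:2502.03208 — 3 statements merged into one kernel-verified Lean document; each statement's English description precedes it below -/
import Mathlib

section
/- For every positive integer n, the maximum of the Spearman footrule distance D(σ,τ) = Σ_{i=1}^n |σ(i) − τ(i)| over all pairs of permutations σ, τ of {1,…,n} equals ⌊n²/2⌋ (that is, n²/2 when n is even and (n²−1)/2 when n is odd). -/
/-- The Spearman footrule (SRD) distance between two permutations of `{1,…,n}`
(identified with `Fin n`): `D(σ,τ) = Σ_i |σ(i) − τ(i)|`. -/
def footrule {n : ℕ} (σ τ : Equiv.Perm (Fin n)) : ℤ :=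
  ∑ i : Fin n, |((σ i : ℕ) : ℤ) - ((τ i : ℕ) : ℤ)|

/-- The numbers `2 i - (n - 1)`, `i < n`, have absolute values summing to `⌊n²/2⌋`. -/
theorem sum_range_abs_two_mul_sub (n : ℕ) :
    ∑ i ∈ Finset.range n, |2 * (i : ℤ) - (n - 1)| = ((n ^ 2 / 2 : ℕ) : ℤ) := by
  induction n using Nat.twoStepInduction with
  | zero => simp
  | one => simp
  | more n ih _ =>
    have hsq : (n + 2) ^ 2 / 2 = n ^ 2 / 2 + 2 * (n + 1) := by
      rw [show (n + 2) ^ 2 = n ^ 2 + 2 * (2 * (n + 1)) by ring]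
      omega
    have hmid : ∀ i ∈ Finset.range n,
        |2 * ((i + 1 : ℕ) : ℤ) - (((n + 2 : ℕ) : ℤ) - 1)| = |2 * (i : ℤ) - (n - 1)| := by
      intro i _
      congr 1
      push_cast
      ring
    have hlast : |2 * ((n + 1 : ℕ) : ℤ) - (((n + 2 : ℕ) : ℤ) - 1)| = n + 1 := by grind
    have hfirst : |2 * ((0 : ℕ) : ℤ) - (((n + 2 : ℕ) : ℤ) - 1)| = n + 1 := by grind
    rw [Finset.sum_range_succ, Finset.sum_range_succ', Finset.sum_congr rfl hmid, ih,
      hlast, hfirst, hsq]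
    push_cast
    ring

theorem sum_fin_abs_two_mul_sub (n : ℕ) :
    ∑ i : Fin n, |2 * ((i : ℕ) : ℤ) - (n - 1)| = ((n ^ 2 / 2 : ℕ) : ℤ) := by
  rw [← sum_range_abs_two_mul_sub]
  exact Fin.sum_univ_eq_sum_range (fun i : ℕ => |2 * (i : ℤ) - (n - 1)|) n

theorem footrule_one_revPerm (n : ℕ) :
    footrule (1 : Equiv.Perm (Fin n)) Fin.revPerm = ((n ^ 2 / 2 : ℕ) : ℤ) := by
  rw [footrule, ← sum_fin_abs_two_mul_sub]
  refine Finset.sum_congr rfl fun i _ => ?_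
  have hi := i.isLt
  simp only [Equiv.Perm.coe_one, id_eq, Fin.revPerm_apply, Fin.val_rev]
  congr 1
  omega

theorem footrule_le_half_sq {n : ℕ} (σ τ : Equiv.Perm (Fin n)) :
    footrule σ τ ≤ ((n ^ 2 / 2 : ℕ) : ℤ) := by
  let f : Fin n → ℤ := fun i => |2 * ((i : ℕ) : ℤ) - (n - 1)|
  have hpoint : ∀ i, 2 * |((σ i : ℕ) : ℤ) - ((τ i : ℕ) : ℤ)| ≤ f (σ i) + f (τ i) := by
    intro i
    simp only [f]
    grind
  have hsum := Finset.sum_le_sum fun i (_ : i ∈ Finset.univ) => hpoint i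
  rw [← Finset.mul_sum, Finset.sum_add_distrib, Equiv.sum_comp σ f, Equiv.sum_comp τ f,
    sum_fin_abs_two_mul_sub] at hsum
  rw [footrule]
  linarith

/-- For every positive integer `n`, the maximum of the Spearman footrule distance
over all pairs of permutations of `{1,…,n}` equals `⌊n²/2⌋`. -/
theorem max_footrule_eq_floor_half_sq (n : ℕ) (hn : 0 < n) :
    IsGreatest {d : ℤ | ∃ σ τ : Equiv.Perm (Fin n), d = footrule σ τ}
      ((n ^ 2 / 2 : ℕ) : ℤ) := by
  refine ⟨⟨1, Fin.revPerm, (footrule_one_revPerm n).symm⟩, ?_⟩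
  rintro _ ⟨σ, τ, rfl⟩
  exact footrule_le_half_sq σ τ
end

section
/- Let p and r be two permutations of {1,…,n} chosen independently and uniformly at random, and let D(p,r) = Σ_{i=1}^n |p(i) − r(i)| be their footrule distance. Then the expected value satisfies E[D(p,r)] = (n²−1)/3; in particular E[D(p,r)] = n²/3 + O(n). -/
/-- The expected value of the footrule distance `D(p,r)` when `p` and `r` are two
permutations of `{1,…,n}` chosen independently and uniformly at random, i.e. the average
of `D` over the uniform probability measure on `S_n × S_n`. -/
noncomputable def expFootrule (n : ℕ) : ℝ :=
  (∑ pr : Equiv.Perm (Fin n) × Equiv.Perm (Fin n), (footrule pr.1 pr.2 : ℝ)) /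
    (Fintype.card (Equiv.Perm (Fin n) × Equiv.Perm (Fin n)) : ℝ)

/-- The variance `E[(D − E[D])²]` of the footrule distance `D(p,r)` when `p` and `r` are
two permutations of `{1,…,n}` chosen independently and uniformly at random. -/
noncomputable def varFootrule (n : ℕ) : ℝ :=
  (∑ pr : Equiv.Perm (Fin n) × Equiv.Perm (Fin n),
      ((footrule pr.1 pr.2 : ℝ) - expFootrule n) ^ 2) /
    (Fintype.card (Equiv.Perm (Fin n) × Equiv.Perm (Fin n)) : ℝ)

/-- If `σ` is a uniformly random permutation of a finite type, then `σ i` is uniform. -/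
theorem card_mul_sum_perm_apply {α : Type*} [Fintype α] [DecidableEq α] (f : α → ℝ) (i : α) :
    (Fintype.card α : ℝ) * ∑ σ : Equiv.Perm α, f (σ i) =
      (Fintype.card (Equiv.Perm α) : ℝ) * ∑ a, f a := by
  have h : ∀ j, ∑ σ : Equiv.Perm α, f (σ j) = ∑ σ : Equiv.Perm α, f (σ i) := fun j =>
    Fintype.sum_equiv (Equiv.mulRight (Equiv.swap i j)) _ _ fun σ => by simp
  calc (Fintype.card α : ℝ) * ∑ σ : Equiv.Perm α, f (σ i)
      = ∑ j, ∑ σ : Equiv.Perm α, f (σ j) := by simp [h]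
    _ = ∑ σ : Equiv.Perm α, ∑ j, f (σ j) := Finset.sum_comm
    _ = (Fintype.card (Equiv.Perm α) : ℝ) * ∑ a, f a := by
      simp only [Equiv.sum_comp, Finset.sum_const, Finset.card_univ, nsmul_eq_mul]

theorem two_mul_sum_range_abs_sub (n : ℕ) :
    2 * ∑ k ∈ Finset.range n, |(n : ℝ) - k| = n * (n + 1) := by
  have h : ∀ k ∈ Finset.range n, |(n : ℝ) - k| = n - k := fun k hk =>
    abs_of_nonneg (sub_nonneg.2 (by exact_mod_cast (Finset.mem_range.1 hk).le))
  have h' : ∀ m : ℕ, 2 * ∑ k ∈ Finset.range m, ((n : ℝ) - k) = m * (2 * n - m + 1) := by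
    intro m
    induction m with
    | zero => simp
    | succ m ih => rw [Finset.sum_range_succ, mul_add, ih]; push_cast; ring
  rw [Finset.sum_congr rfl h, h']
  ring

theorem three_mul_sum_range_abs_sub (n : ℕ) :
    3 * ∑ a ∈ Finset.range n, ∑ b ∈ Finset.range n, |(a : ℝ) - b| = n * ((n : ℝ) ^ 2 - 1) := by
  induction n with
  | zero => simp
  | succ n ih =>
    have h := two_mul_sum_range_abs_sub n
    have h' : ∑ a ∈ Finset.range n, |(a : ℝ) - n| = ∑ k ∈ Finset.range n, |(n : ℝ) - k| :=
      Finset.sum_congr rfl fun _ _ => abs_sub_comm _ _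
    simp only [Finset.sum_range_succ, Finset.sum_add_distrib, sub_self, abs_zero, h']
    push_cast
    linear_combination ih + 3 * h

theorem three_mul_sum_fin_abs_sub (n : ℕ) :
    3 * ∑ a : Fin n, ∑ b : Fin n, |((a : ℕ) : ℝ) - ((b : ℕ) : ℝ)| = n * ((n : ℝ) ^ 2 - 1) := by
  rw [← three_mul_sum_range_abs_sub, Finset.sum_range]
  simp only [Finset.sum_range]

/-- If `p` and `r` are two permutations of `{1,…,n}` chosen independently and uniformly
at random, then `E[D(p,r)] = (n²−1)/3`. -/
theorem expFootrule_eq (n : ℕ) (hn : 0 < n) :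
    expFootrule n = ((n : ℝ) ^ 2 - 1) / 3 := by
  have hn' : (n : ℝ) ≠ 0 := by exact_mod_cast hn.ne'
  have hN : (Fintype.card (Equiv.Perm (Fin n)) : ℝ) ≠ 0 := by
    exact_mod_cast Fintype.card_ne_zero
  have key : ∀ i : Fin n, (n : ℝ) * (n * ∑ p : Equiv.Perm (Fin n), ∑ r : Equiv.Perm (Fin n),
      |((p i : ℕ) : ℝ) - ((r i : ℕ) : ℝ)|) =
      (Fintype.card (Equiv.Perm (Fin n)) : ℝ) * (Fintype.card (Equiv.Perm (Fin n)) *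
        ∑ a : Fin n, ∑ b : Fin n, |((a : ℕ) : ℝ) - ((b : ℕ) : ℝ)|) := by
    intro i
    have h₁ : ∀ a : Fin n, (n : ℝ) * ∑ r : Equiv.Perm (Fin n), |((a : ℕ) : ℝ) - ((r i : ℕ) : ℝ)| =
        (Fintype.card (Equiv.Perm (Fin n)) : ℝ) *
          ∑ b : Fin n, |((a : ℕ) : ℝ) - ((b : ℕ) : ℝ)| := fun a => by
      simpa only [Fintype.card_fin] using
        card_mul_sum_perm_apply (fun b : Fin n => |((a : ℕ) : ℝ) - ((b : ℕ) : ℝ)|) i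
    have h₂ := card_mul_sum_perm_apply
      (fun a : Fin n => ∑ b : Fin n, |((a : ℕ) : ℝ) - ((b : ℕ) : ℝ)|) i
    rw [Fintype.card_fin] at h₂
    rw [Finset.mul_sum, Finset.sum_congr rfl fun p _ => h₁ (p i), ← Finset.mul_sum, ← h₂]
    ring
  have hsum : ∑ pr : Equiv.Perm (Fin n) × Equiv.Perm (Fin n), (footrule pr.1 pr.2 : ℝ) =
      ∑ i : Fin n, ∑ p : Equiv.Perm (Fin n), ∑ r : Equiv.Perm (Fin n),
        |((p i : ℕ) : ℝ) - ((r i : ℕ) : ℝ)| := by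
    simp only [footrule, Int.cast_sum, Int.cast_abs, Int.cast_sub, Int.cast_natCast]
    rw [Finset.sum_comm]
    exact Finset.sum_congr rfl fun i _ => Fintype.sum_prod_type _
  have hS : (n : ℝ) * (n * ∑ pr : Equiv.Perm (Fin n) × Equiv.Perm (Fin n),
      (footrule pr.1 pr.2 : ℝ)) = n * ((Fintype.card (Equiv.Perm (Fin n)) : ℝ) *
        (Fintype.card (Equiv.Perm (Fin n)) *
          ∑ a : Fin n, ∑ b : Fin n, |((a : ℕ) : ℝ) - ((b : ℕ) : ℝ)|)) := by
    rw [hsum, Finset.mul_sum, Finset.mul_sum, Finset.sum_congr rfl fun i _ => key i]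
    simp
  have h3 := three_mul_sum_fin_abs_sub n
  rw [expFootrule, Fintype.card_prod, Nat.cast_mul, div_eq_div_iff (mul_ne_zero hN hN) three_ne_zero]
  refine mul_left_cancel₀ (mul_ne_zero hn' hn') ?_
  linear_combination 3 * hS + n * (Fintype.card (Equiv.Perm (Fin n)) : ℝ) ^ 2 * h3
end

section
/- Let p and r be two permutations of {1,…,n} chosen independently and uniformly at random, and let D_n = Σ_{i=1}^n |p(i) − r(i)| be their footrule distance. Then D_n is asymptotically normal: as n → ∞, the laws of the standardized random variables (D_n − E[D_n])/√(Var(D_n)) converge weakly (in distribution) to the standard Gaussian measure on ℝ with mean 0 and variance 1. -/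
open MeasureTheory ProbabilityTheory Filter

/-- The law (distribution) of the standardized footrule distance
`(D_n − E[D_n]) / √(Var(D_n))`, where `D_n = D(p,r)` for `p`, `r` independent uniformly
random permutations of `{1,…,n}`: the pushforward of the uniform probability measure on
`S_n × S_n` under the standardized statistic, as a probability measure on `ℝ`. -/
noncomputable def stdFootruleLaw (n : ℕ) : ProbabilityMeasure ℝ :=
  ⟨((PMF.uniformOfFintype (Equiv.Perm (Fin n) × Equiv.Perm (Fin n))).map
      (fun pr => ((footrule pr.1 pr.2 : ℝ) - expFootrule n) /
        Real.sqrt (varFootrule n))).toMeasure, inferInstance⟩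

/-- **Poincaré inequality for random transpositions**: a function on `Perm (Fin n)` which changes
by at most `c` under composition with a transposition has variance at most `n * c ^ 2`. -/
theorem sum_sq_le_of_forall_mul_swap {n : ℕ} {c : ℝ} (f : Equiv.Perm (Fin n) → ℝ)
    (hf : ∀ π i j, |f (π * Equiv.swap i j) - f π| ≤ c) :
    ∑ π, f π ^ 2 ≤ (∑ π, f π) ^ 2 / n.factorial + n * c ^ 2 * n.factorial := by
  induction n with
  | zero => simp
  | succ n ih =>
    have hc : 0 ≤ c := (abs_nonneg _).trans (hf 1 0 0)
    let L : Equiv.Perm (Fin n) → Equiv.Perm (Fin (n + 1)) :=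
      fun e ↦ Equiv.Perm.decomposeFin.symm (0, e)
    have hL (k : Fin (n + 1)) (e : Equiv.Perm (Fin n)) :
        Equiv.Perm.decomposeFin.symm (k, e) = Equiv.swap 0 k * L e := by
      ext x
      cases x using Fin.cases <;> simp [L]
    have hLswap (e : Equiv.Perm (Fin n)) (i j : Fin n) :
        L (e * Equiv.swap i j) = L e * Equiv.swap i.succ j.succ := by
      ext x
      cases x using Fin.cases with
      | zero => simp [L, Equiv.swap_apply_of_ne_of_ne (Fin.succ_ne_zero i).symm
          (Fin.succ_ne_zero j).symm]
      | succ x => simp [L, ← (Fin.succ_injective n).map_swap]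
    let g : Fin (n + 1) → Equiv.Perm (Fin n) → ℝ := fun k e ↦ f (Equiv.swap 0 k * L e)
    let G : Fin (n + 1) → ℝ := fun k ↦ ∑ e, g k e
    have hsum (F : ℝ → ℝ) : ∑ π, F (f π) = ∑ k, ∑ e, F (g k e) := by
      rw [← Fintype.sum_prod_type', ← Equiv.Perm.decomposeFin.symm.sum_comp]
      simp [g, hL]
    have hg (k : Fin (n + 1)) :
        ∑ e, g k e ^ 2 ≤ G k ^ 2 / n.factorial + n * c ^ 2 * n.factorial := by
      refine ih (g k) fun e i j ↦ ?_
      simpa only [g, hLswap, ← mul_assoc] using hf (Equiv.swap 0 k * L e) i.succ j.succ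
    have hG (k : Fin (n + 1)) : |G k - G 0| ≤ n.factorial * c := by
      calc |G k - G 0| ≤ ∑ e, |g k e - g 0 e| := by
            simp only [G, ← Finset.sum_sub_distrib]
            exact Finset.abs_sum_le_sum_abs _ _
        _ ≤ ∑ _e : Equiv.Perm (Fin n), c := by
            refine Finset.sum_le_sum fun e _ ↦ ?_
            have := hf (L e) ((L e)⁻¹ 0) ((L e)⁻¹ k)
            have h0 : Equiv.swap 0 0 * L e = L e := by rw [Equiv.swap_self]; rfl
            rw [← Equiv.swap_mul_eq_mul_swap] at this
            simpa only [g, h0] using this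
        _ = n.factorial * c := by simp [Fintype.card_perm]
    have hvar : ∑ k, G k ^ 2 ≤ (∑ k, G k) ^ 2 / (n + 1) + (n + 1) * (n.factorial * c) ^ 2 := by
      have h1 : ∑ k, (G k - G 0) ^ 2 ≤ (n + 1) * (n.factorial * c) ^ 2 := by
        calc _ ≤ ∑ _k : Fin (n + 1), (n.factorial * c) ^ 2 :=
              Finset.sum_le_sum fun k _ ↦ sq_le_sq' (abs_le.1 (hG k)).1 (abs_le.1 (hG k)).2
          _ = _ := by simp
      have h2 : ∑ k, (G k - G 0) ^ 2 =
          ∑ k, G k ^ 2 - 2 * G 0 * ∑ k, G k + (n + 1) * G 0 ^ 2 := by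
        simp only [sub_sq, Finset.sum_add_distrib, Finset.sum_sub_distrib, Finset.mul_sum]
        simp only [Finset.sum_const, Finset.card_univ, Fintype.card_fin, nsmul_eq_mul,
          Nat.cast_add, Nat.cast_one, add_left_inj, sub_right_inj]
        exact Finset.sum_congr rfl fun k _ ↦ by ring
      have h3 : 0 ≤ (∑ k, G k) ^ 2 / (n + 1) - 2 * G 0 * ∑ k, G k + (n + 1) * G 0 ^ 2 := by
        have h : (∑ k, G k) ^ 2 / (n + 1) - 2 * G 0 * ∑ k, G k + (n + 1) * G 0 ^ 2 =
            (∑ k, G k - (n + 1) * G 0) ^ 2 / (n + 1) := by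
          field_simp
          ring
        rw [h]
        positivity
      linarith
    have hfact : (0 : ℝ) < n.factorial := by positivity
    rw [hsum (· ^ 2), hsum fun x ↦ x]
    calc ∑ k, ∑ e, g k e ^ 2
        ≤ ∑ k, (G k ^ 2 / n.factorial + n * c ^ 2 * n.factorial) :=
          Finset.sum_le_sum fun k _ ↦ hg k
      _ = (∑ k, G k ^ 2) / n.factorial + (n + 1) * (n * c ^ 2 * n.factorial) := by
          simp [Finset.sum_add_distrib, Finset.sum_div]
      _ ≤ ((∑ k, G k) ^ 2 / (n + 1) + (n + 1) * (n.factorial * c) ^ 2) / n.factorial +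
          (n + 1) * (n * c ^ 2 * n.factorial) := by gcongr
      _ = _ := by
          rw [Nat.factorial_succ]
          push_cast
          field_simp
          ring

/-- The statistic `∑ i, a i (π i)` of a permutation `π` attached to a square array `a`. -/
def permStat {n : ℕ} (a : Fin n → Fin n → ℝ) (π : Equiv.Perm (Fin n)) : ℝ :=
  ∑ i, a i (π i)

/-- The change of `permStat a π` when `π` is composed with `Equiv.swap i j`. -/
def swapDiff {n : ℕ} (a : Fin n → Fin n → ℝ) (π : Equiv.Perm (Fin n)) (i j : Fin n) : ℝ :=
  a i (π i) + a j (π j) - a i (π j) - a j (π i)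

section PermStat

variable {n : ℕ} (a : Fin n → Fin n → ℝ)

theorem permStat_mul_swap (π : Equiv.Perm (Fin n)) (i j : Fin n) :
    permStat a (π * Equiv.swap i j) = permStat a π - swapDiff a π i j := by
  rcases eq_or_ne i j with rfl | hij
  · have h : π * Equiv.swap i i = π := by rw [Equiv.swap_self]; rfl
    rw [h]
    simp [swapDiff]
  · have h : permStat a π - permStat a (π * Equiv.swap i j) = swapDiff a π i j := by
      unfold permStat
      rw [← Finset.sum_sub_distrib, Fintype.sum_eq_add i j hij]
      · simp only [swapDiff, Equiv.Perm.mul_apply, Equiv.swap_apply_left, Equiv.swap_apply_right]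
        ring
      · rintro k ⟨hki, hkj⟩
        simp [Equiv.swap_apply_of_ne_of_ne hki hkj]
    linarith

theorem swapDiff_mul_swap (π : Equiv.Perm (Fin n)) (i j : Fin n) :
    swapDiff a (π * Equiv.swap i j) i j = -swapDiff a π i j := by
  simp only [swapDiff, Equiv.Perm.mul_apply, Equiv.swap_apply_left, Equiv.swap_apply_right]
  ring

theorem sum_swapDiff (π : Equiv.Perm (Fin n)) :
    ∑ i, ∑ j, swapDiff a π i j = 2 * n * permStat a π - 2 * ∑ i, ∑ j, a i j := by
  have h1 : ∑ i, ∑ j, a i (π j) = ∑ i, ∑ j, a i j :=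
    Finset.sum_congr rfl fun i _ ↦ Equiv.sum_comp π (a i)
  have h2 : ∑ i, ∑ j, a j (π i) = ∑ i, ∑ j, a i j := by rw [Finset.sum_comm, h1]
  simp only [swapDiff, Finset.sum_sub_distrib, Finset.sum_add_distrib, h1, h2]
  simp [permStat, ← Finset.mul_sum]
  ring

/-- Exchangeability of `π` and `π * Equiv.swap i j` for a uniformly random permutation `π`. -/
theorem sum_swapDiff_mul {E : Type*} [NormedAddCommGroup E] [NormedSpace ℝ E]
    (f : Equiv.Perm (Fin n) → E) (i j : Fin n) :
    (2 : ℝ) • ∑ π, swapDiff a π i j • f π =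
      ∑ π, swapDiff a π i j • (f π - f (π * Equiv.swap i j)) := by
  have h : ∑ π, swapDiff a π i j • f (π * Equiv.swap i j) = -∑ π, swapDiff a π i j • f π := by
    rw [← Equiv.sum_comp (Equiv.mulRight (Equiv.swap i j)), ← Finset.sum_neg_distrib]
    simp [swapDiff_mul_swap, mul_assoc]
  simp only [smul_sub, Finset.sum_sub_distrib, h, two_smul, sub_neg_eq_add]

/-- The mean squared increment of `permStat a π` under a random transposition, normalized so
that its mean is the variance of `permStat a`. -/
noncomputable def swapVar (π : Equiv.Perm (Fin n)) : ℝ :=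
  (∑ i, ∑ j, swapDiff a π i j ^ 2) / (4 * n)

variable {a}

theorem sum_permStat (a : Fin n → Fin n → ℝ) (hn : n ≠ 0) :
    ∑ π, permStat a π = n.factorial * ((∑ i, ∑ j, a i j) / n) := by
  have h : ∑ π, ∑ i, ∑ j, swapDiff a π i j = 0 := by
    rw [Finset.sum_comm]
    refine Finset.sum_eq_zero fun i _ ↦ ?_
    rw [Finset.sum_comm]
    refine Finset.sum_eq_zero fun j _ ↦ ?_
    simpa using sum_swapDiff_mul a (fun _ ↦ (1 : ℝ)) i j
  simp only [sum_swapDiff, Finset.sum_sub_distrib, ← Finset.mul_sum] at h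
  simp only [Finset.sum_const, Finset.card_univ, Fintype.card_perm, Fintype.card_fin,
    nsmul_eq_mul] at h
  have hn' : (n : ℝ) ≠ 0 := by exact_mod_cast hn
  field_simp
  linarith

theorem smul_sum_permStat_smul {E : Type*} [NormedAddCommGroup E] [NormedSpace ℝ E]
    (ha : ∑ i, ∑ j, a i j = 0) (f : Equiv.Perm (Fin n) → E) :
    (4 * n : ℝ) • ∑ π, permStat a π • f π =
      ∑ π, ∑ i, ∑ j, swapDiff a π i j • (f π - f (π * Equiv.swap i j)) := by
  have h (π : Equiv.Perm (Fin n)) :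
      (2 * n : ℝ) • permStat a π • f π = ∑ i, ∑ j, swapDiff a π i j • f π := by
    simp only [← Finset.sum_smul]
    rw [sum_swapDiff, ha, smul_smul, mul_zero, sub_zero]
  have h4 : (4 * n : ℝ) = 2 * (2 * n) := by ring
  rw [h4, mul_smul, Finset.smul_sum]
  simp only [h]
  rw [Finset.sum_comm, Finset.sum_comm (s := Finset.univ) (t := Finset.univ)
    (f := fun π i ↦ ∑ j, swapDiff a π i j • (f π - f (π * Equiv.swap i j))), Finset.smul_sum]
  refine Finset.sum_congr rfl fun i _ ↦ ?_
  rw [Finset.sum_comm, Finset.sum_comm (s := Finset.univ) (t := Finset.univ)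
    (f := fun π j ↦ swapDiff a π i j • (f π - f (π * Equiv.swap i j))), Finset.smul_sum]
  exact Finset.sum_congr rfl fun j _ ↦ sum_swapDiff_mul a f i j

theorem sum_swapVar (hn : n ≠ 0) (ha : ∑ i, ∑ j, a i j = 0) :
    ∑ π, swapVar a π = ∑ π, permStat a π ^ 2 := by
  have hn' : (n : ℝ) ≠ 0 := by exact_mod_cast hn
  have h := smul_sum_permStat_smul ha (permStat a)
  simp only [permStat_mul_swap, sub_sub_cancel, smul_eq_mul, ← sq] at h
  simp only [swapVar, ← Finset.sum_div]
  rw [← h]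
  field_simp

theorem swapDiff_mul_swap_of_ne (π : Equiv.Perm (Fin n)) {p q i j : Fin n} (hip : i ≠ p)
    (hiq : i ≠ q) (hjp : j ≠ p) (hjq : j ≠ q) :
    swapDiff a (π * Equiv.swap p q) i j = swapDiff a π i j := by
  simp [swapDiff, Equiv.swap_apply_of_ne_of_ne, *]

theorem abs_swapVar_mul_swap_sub_le {δ : ℝ} (hδ : ∀ π i j, |swapDiff a π i j| ≤ δ)
    (π : Equiv.Perm (Fin n)) (p q : Fin n) :
    |swapVar a (π * Equiv.swap p q) - swapVar a π| ≤ δ ^ 2 := by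
  have hn : (0 : ℝ) < n := by exact_mod_cast p.pos
  have hsq (π i j) : swapDiff a π i j ^ 2 ≤ δ ^ 2 :=
    sq_le_sq' (abs_le.1 (hδ π i j)).1 (abs_le.1 (hδ π i j)).2
  let ind (k l : Fin n) : ℝ := if k = l then δ ^ 2 else 0
  have hind (k l : Fin n) : 0 ≤ ind k l := by
    simp only [ind]
    split_ifs <;> positivity
  have hterm (i j : Fin n) :
      |swapDiff a (π * Equiv.swap p q) i j ^ 2 - swapDiff a π i j ^ 2| ≤
        ind i p + ind i q + ind j p + ind j q := by
    by_cases h : i ≠ p ∧ i ≠ q ∧ j ≠ p ∧ j ≠ q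
    · rw [swapDiff_mul_swap_of_ne π h.1 h.2.1 h.2.2.1 h.2.2.2, sub_self, abs_zero]
      linarith [hind i p, hind i q, hind j p, hind j q]
    · have h1 : |swapDiff a (π * Equiv.swap p q) i j ^ 2 - swapDiff a π i j ^ 2| ≤ δ ^ 2 :=
        abs_sub_le_of_nonneg_of_le (sq_nonneg _) (hsq _ _ _) (sq_nonneg _) (hsq _ _ _)
      refine h1.trans ?_
      have h2 : ind i p = δ ^ 2 ∨ ind i q = δ ^ 2 ∨ ind j p = δ ^ 2 ∨ ind j q = δ ^ 2 := by
        simp only [ind]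
        grind
      rcases h2 with h2 | h2 | h2 | h2 <;>
        linarith [hind i p, hind i q, hind j p, hind j q]
  rw [swapVar, swapVar, ← sub_div, abs_div, abs_of_pos (by positivity : (0 : ℝ) < 4 * n),
    div_le_iff₀ (by positivity)]
  simp only [← Finset.sum_sub_distrib]
  calc _ ≤ ∑ i, ∑ j, |swapDiff a (π * Equiv.swap p q) i j ^ 2 - swapDiff a π i j ^ 2| :=
        (Finset.abs_sum_le_sum_abs _ _).trans
          (Finset.sum_le_sum fun i _ ↦ Finset.abs_sum_le_sum_abs _ _)
    _ ≤ ∑ i, ∑ j, (ind i p + ind i q + ind j p + ind j q) :=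
        Finset.sum_le_sum fun i _ ↦ Finset.sum_le_sum fun j _ ↦ hterm i j
    _ = δ ^ 2 * (4 * n) := by
        simp [ind, Finset.sum_add_distrib]
        ring

theorem sum_abs_one_sub_swapVar_le {δ : ℝ} (hn : n ≠ 0) (ha : ∑ i, ∑ j, a i j = 0)
    (hvar : ∑ π, permStat a π ^ 2 = n.factorial) (hδ : ∀ π i j, |swapDiff a π i j| ≤ δ) :
    ∑ π, |1 - swapVar a π| ≤ n.factorial * (√n * δ ^ 2) := by
  have hV : ∑ π, swapVar a π = n.factorial := (sum_swapVar hn ha).trans hvar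
  have hfact : (0 : ℝ) < n.factorial := by positivity
  have h1 := sum_sq_le_of_forall_mul_swap (swapVar a) (abs_swapVar_mul_swap_sub_le hδ)
  rw [hV, sq (n.factorial : ℝ), mul_div_cancel_right₀ _ hfact.ne'] at h1
  have h2 : ∑ π, |1 - swapVar a π| ^ 2 ≤ n * (δ ^ 2) ^ 2 * n.factorial := by
    simp only [sq_abs, sub_sq, Finset.sum_add_distrib, Finset.sum_sub_distrib, ← Finset.mul_sum,
      one_pow, mul_one, hV]
    simp only [Finset.sum_const, Finset.card_univ, Fintype.card_perm, Fintype.card_fin,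
      nsmul_eq_mul]
    linarith
  refine abs_le_of_sq_le_sq' ?_ (by positivity) |>.2
  calc (∑ π, |1 - swapVar a π|) ^ 2 ≤ n.factorial * ∑ π, |1 - swapVar a π| ^ 2 := by
        simpa [Fintype.card_perm] using
          sq_sum_le_card_mul_sum_sq (s := Finset.univ) (f := fun π ↦ |1 - swapVar a π|)
    _ ≤ n.factorial * (n * (δ ^ 2) ^ 2 * n.factorial) := by gcongr
    _ = (n.factorial * (√n * δ ^ 2)) ^ 2 := by
        simp only [mul_pow, Real.sq_sqrt n.cast_nonneg]
        ring

end PermStat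

theorem norm_exp_ofReal_mul_I_sub_one_sub_le (x : ℝ) :
    ‖Complex.exp (x * Complex.I) - 1 - x * Complex.I‖ ≤ x ^ 2 := by
  let g : ℝ → ℂ := fun y ↦ Complex.exp (y * Complex.I) - 1 - y * Complex.I
  have hd (y : ℝ) : HasDerivAt g (Complex.exp (y * Complex.I) * Complex.I - Complex.I) y := by
    have h : HasDerivAt (fun y : ℝ ↦ (y : ℂ) * Complex.I) Complex.I y := by
      simpa using (Complex.ofRealCLM.hasDerivAt (x := y)).mul_const Complex.I
    exact (h.cexp.sub_const 1).sub h
  have hb (y : ℝ) (hy : y ∈ Set.uIcc 0 x) :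
      ‖Complex.exp (y * Complex.I) * Complex.I - Complex.I‖ ≤ |x| := by
    have h : Complex.exp (y * Complex.I) * Complex.I - Complex.I =
        (Complex.exp (Complex.I * y) - 1) * Complex.I := by
      rw [mul_comm Complex.I]
      ring
    rw [h, norm_mul, Complex.norm_I, mul_one]
    refine Real.norm_exp_I_mul_ofReal_sub_one_le.trans ?_
    simpa using Set.abs_sub_left_of_mem_uIcc hy
  have h := Convex.norm_image_sub_le_of_norm_hasDerivWithin_le
    (fun y _ ↦ (hd y).hasDerivWithinAt) hb (convex_uIcc 0 x) Set.left_mem_uIcc Set.right_mem_uIcc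
  simpa [g, ← sq] using h

section CharacteristicFunction

variable {n : ℕ} {a : Fin n → Fin n → ℝ}

/-- Stein's identity in Fourier form: the unnormalized characteristic function `F` of
`permStat a` nearly satisfies `F' t = -t * F t`. -/
theorem norm_deriv_add_mul_sum_exp_le {δ : ℝ} (hn : n ≠ 0) (ha : ∑ i, ∑ j, a i j = 0)
    (hvar : ∑ π, permStat a π ^ 2 = n.factorial) (hδ : ∀ π i j, |swapDiff a π i j| ≤ δ) (t : ℝ) :
    ‖∑ π, Complex.exp (t * permStat a π * Complex.I) * (permStat a π * Complex.I) +
        t * ∑ π, Complex.exp (t * permStat a π * Complex.I)‖ ≤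
      n.factorial * (t ^ 2 * δ + |t| * (√n * δ ^ 2)) := by
  have hn0 : (0 : ℝ) < n := by exact_mod_cast Nat.pos_of_ne_zero hn
  set e : Equiv.Perm (Fin n) → ℂ := fun π ↦ Complex.exp (t * permStat a π * Complex.I) with he
  have hnorm (π : Equiv.Perm (Fin n)) : ‖e π‖ = 1 := by
    simp only [he, ← Complex.ofReal_mul, Complex.norm_exp_ofReal_mul_I]
  let R (π : Equiv.Perm (Fin n)) (i j : Fin n) : ℂ :=
    swapDiff a π i j • (e π * Complex.I - e (π * Equiv.swap i j) * Complex.I) +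
      (t * swapDiff a π i j ^ 2 : ℝ) * e π
  have hR (π i j) : ‖R π i j‖ ≤ t ^ 2 * δ * swapDiff a π i j ^ 2 := by
    have hexp : e (π * Equiv.swap i j) =
        e π * Complex.exp ((-(t * swapDiff a π i j) : ℝ) * Complex.I) := by
      simp only [he, permStat_mul_swap, ← Complex.exp_add]
      congr 1
      push_cast
      ring
    have h : R π i j = -(swapDiff a π i j * Complex.I * e π *
        (Complex.exp ((-(t * swapDiff a π i j) : ℝ) * Complex.I) - 1 -
          (-(t * swapDiff a π i j) : ℝ) * Complex.I)) := by
      simp only [R, hexp, Complex.real_smul]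
      push_cast
      linear_combination (swapDiff a π i j : ℂ) ^ 2 * t * e π * Complex.I_sq
    rw [h, norm_neg, norm_mul, norm_mul, norm_mul, hnorm, Complex.norm_I, Complex.norm_real,
      Real.norm_eq_abs, mul_one, mul_one]
    calc |swapDiff a π i j| * _ ≤ δ * (-(t * swapDiff a π i j)) ^ 2 := by
          gcongr
          · exact (abs_nonneg _).trans (hδ π i j)
          · exact hδ π i j
          · exact norm_exp_ofReal_mul_I_sub_one_sub_le _
      _ = t ^ 2 * δ * swapDiff a π i j ^ 2 := by ring
  have hsumV (π : Equiv.Perm (Fin n)) :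
      ∑ i, ∑ j, swapDiff a π i j ^ 2 = 4 * n * swapVar a π := by
    rw [swapVar]
    field_simp
  have hdecomp : (4 * n : ℝ) • (∑ π, e π * (permStat a π * Complex.I) + t * ∑ π, e π) =
      ∑ π, ∑ i, ∑ j, R π i j + (4 * n * t : ℝ) * ∑ π, (1 - swapVar a π : ℝ) * e π := by
    have h1 := smul_sum_permStat_smul ha (fun π ↦ e π * Complex.I)
    have h2 : ∑ π, e π * (permStat a π * Complex.I) =
        ∑ π, permStat a π • (e π * Complex.I) :=
      Finset.sum_congr rfl fun π _ ↦ by rw [Complex.real_smul]; ring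
    have h3 : ∑ π, ∑ i, ∑ j, ((t * swapDiff a π i j ^ 2 : ℝ) : ℂ) * e π =
        (4 * n * t : ℝ) * ∑ π, (swapVar a π : ℝ) * e π := by
      rw [Finset.mul_sum]
      refine Finset.sum_congr rfl fun π _ ↦ ?_
      simp only [← Finset.sum_mul, ← Complex.ofReal_sum, ← Finset.mul_sum, hsumV]
      push_cast
      ring
    simp only [R, Finset.sum_add_distrib]
    rw [smul_add, h2, h1, h3]
    simp only [Complex.ofReal_sub, sub_mul, Finset.sum_sub_distrib, Complex.real_smul]
    push_cast
    simp only [one_mul]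
    ring
  have hfinal : 4 * n * ‖∑ π, e π * (permStat a π * Complex.I) + t * ∑ π, e π‖ ≤
      4 * n * (n.factorial * (t ^ 2 * δ + |t| * (√n * δ ^ 2))) := by
    have h4 : ‖∑ π, ∑ i, ∑ j, R π i j‖ ≤ 4 * n * (n.factorial * (t ^ 2 * δ)) := by
      calc _ ≤ ∑ π, ∑ i, ∑ j, t ^ 2 * δ * swapDiff a π i j ^ 2 :=
            norm_sum_le_of_le _ fun π _ ↦ norm_sum_le_of_le _ fun i _ ↦
              norm_sum_le_of_le _ fun j _ ↦ hR π i j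
        _ = _ := by
            simp only [← Finset.mul_sum, hsumV]
            rw [sum_swapVar hn ha, hvar]
            ring
    have h5 : ‖∑ π, ((1 - swapVar a π : ℝ) : ℂ) * e π‖ ≤ n.factorial * (√n * δ ^ 2) := by
      refine (norm_sum_le_of_le _ fun π _ ↦ ?_).trans (sum_abs_one_sub_swapVar_le hn ha hvar hδ)
      rw [norm_mul, hnorm, mul_one, Complex.norm_real, Real.norm_eq_abs]
    have h6 : ‖(4 * n : ℝ) • (∑ π, e π * (permStat a π * Complex.I) + t * ∑ π, e π)‖ =
        4 * n * ‖∑ π, e π * (permStat a π * Complex.I) + t * ∑ π, e π‖ := by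
      rw [norm_smul, Real.norm_of_nonneg (by positivity)]
    rw [← h6, hdecomp]
    refine (norm_add_le _ _).trans ?_
    rw [norm_mul, Complex.norm_real, Real.norm_eq_abs, abs_mul,
      abs_of_pos (by positivity : (0 : ℝ) < 4 * n)]
    calc _ ≤ 4 * n * (n.factorial * (t ^ 2 * δ)) +
          4 * n * |t| * (n.factorial * (√n * δ ^ 2)) := by gcongr
      _ = _ := by ring
  exact le_of_mul_le_mul_left hfinal (by positivity)

/-- A quantitative combinatorial central limit theorem, in terms of characteristic functions. -/
theorem norm_sum_exp_permStat_sub_le {δ : ℝ} (hn : n ≠ 0) (ha : ∑ i, ∑ j, a i j = 0)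
    (hvar : ∑ π, permStat a π ^ 2 = n.factorial) (hδ : ∀ π i j, |swapDiff a π i j| ≤ δ) (t : ℝ) :
    ‖(∑ π, Complex.exp (t * permStat a π * Complex.I)) / n.factorial -
        Complex.exp (-(t ^ 2 / 2))‖ ≤ (t ^ 2 * δ + |t| * (√n * δ ^ 2)) * |t| := by
  have hδ0 : 0 ≤ δ := by
    have i : Fin n := ⟨0, Nat.pos_of_ne_zero hn⟩
    exact (abs_nonneg _).trans (hδ 1 i i)
  let F : ℝ → ℂ := fun s ↦ ∑ π, Complex.exp (s * permStat a π * Complex.I)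
  let F' : ℝ → ℂ := fun s ↦
    ∑ π, Complex.exp (s * permStat a π * Complex.I) * (permStat a π * Complex.I)
  have hid (s : ℝ) : HasDerivAt (fun s : ℝ ↦ (s : ℂ)) 1 s := Complex.ofRealCLM.hasDerivAt
  have hF (s : ℝ) : HasDerivAt F (F' s) s := by
    refine HasDerivAt.fun_sum fun π _ ↦ ?_
    simpa using (((hid s).mul_const (permStat a π : ℂ)).mul_const Complex.I).cexp
  have hgauss (s : ℝ) : HasDerivAt (fun s : ℝ ↦ Complex.exp (s ^ 2 / 2))
      (Complex.exp (s ^ 2 / 2) * s) s := by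
    refine (((hid s).fun_pow 2).div_const 2).cexp.congr_deriv ?_
    simp
  have hprod (s : ℝ) : HasDerivAt (fun s ↦ F s * Complex.exp (s ^ 2 / 2))
      ((F' s + s * F s) * Complex.exp (s ^ 2 / 2)) s := by
    refine ((hF s).fun_mul (hgauss s)).congr_deriv ?_
    ring
  have hnorm_gauss (s : ℝ) : ‖Complex.exp ((s : ℂ) ^ 2 / 2)‖ = Real.exp (s ^ 2 / 2) := by
    rw [← Complex.norm_of_nonneg (Real.exp_pos _).le]
    push_cast
    rfl
  set C : ℝ := t ^ 2 * δ + |t| * (√n * δ ^ 2) with hC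
  have hbound (s : ℝ) (hs : s ∈ Set.uIcc 0 t) :
      ‖(F' s + s * F s) * Complex.exp (s ^ 2 / 2)‖ ≤
        n.factorial * C * Real.exp (t ^ 2 / 2) := by
    have hst : |s| ≤ |t| := by simpa using Set.abs_sub_left_of_mem_uIcc hs
    have hst2 : s ^ 2 ≤ t ^ 2 := sq_le_sq.2 hst
    rw [norm_mul, hnorm_gauss]
    have h := norm_deriv_add_mul_sum_exp_le hn ha hvar hδ s
    calc _ ≤ n.factorial * (s ^ 2 * δ + |s| * (√n * δ ^ 2)) * Real.exp (s ^ 2 / 2) := by gcongr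
      _ ≤ _ := by
          rw [hC]
          gcongr
  have h := Convex.norm_image_sub_le_of_norm_hasDerivWithin_le
    (fun s _ ↦ (hprod s).hasDerivWithinAt) hbound (convex_uIcc 0 t) Set.left_mem_uIcc
    Set.right_mem_uIcc
  have hF0 : F 0 * Complex.exp (((0 : ℝ) : ℂ) ^ 2 / 2) = n.factorial := by
    simp [F, Fintype.card_perm]
  rw [hF0, sub_zero, Real.norm_eq_abs] at h
  have hkey : F t / n.factorial - Complex.exp (-(t ^ 2 / 2)) =
      (F t * Complex.exp (t ^ 2 / 2) - n.factorial) /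
        (n.factorial * Complex.exp (t ^ 2 / 2)) := by
    have h1 : (n.factorial : ℂ) ≠ 0 := by exact_mod_cast n.factorial_ne_zero
    rw [Complex.exp_neg]
    field_simp [Complex.exp_ne_zero]
  change ‖F t / n.factorial - Complex.exp (-(t ^ 2 / 2))‖ ≤ C * |t|
  rw [hkey, norm_div, norm_mul, hnorm_gauss, Complex.norm_natCast, div_le_iff₀ (by positivity)]
  calc _ ≤ _ := h
    _ = _ := by ring

end CharacteristicFunction

section Footrule

/-- The array `|i - j|` whose permutation statistic is the distance to the identity. -/
def distArray (n : ℕ) (i j : Fin n) : ℝ := |(i : ℝ) - j|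

theorem footrule_eq_permStat {n : ℕ} (σ τ : Equiv.Perm (Fin n)) :
    (footrule σ τ : ℝ) = permStat (distArray n) (τ * σ⁻¹) := by
  simp only [footrule, permStat, distArray, Int.cast_sum, Int.cast_abs, Int.cast_sub,
    Int.cast_natCast]
  rw [← Equiv.sum_comp σ fun i ↦ |(i : ℝ) - ((τ * σ⁻¹) i : ℕ)|]
  simp

theorem sum_footrule {n : ℕ} {E : Type*} [AddCommMonoid E] (f : ℝ → E) :
    ∑ pr : Equiv.Perm (Fin n) × Equiv.Perm (Fin n), f (footrule pr.1 pr.2) =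
      n.factorial • ∑ π, f (permStat (distArray n) π) := by
  simp only [footrule_eq_permStat, Fintype.sum_prod_type]
  have h (σ : Equiv.Perm (Fin n)) : ∑ τ, f (permStat (distArray n) (τ * σ⁻¹)) =
      ∑ π, f (permStat (distArray n) π) :=
    Equiv.sum_comp (Equiv.mulRight σ⁻¹) fun π ↦ f (permStat (distArray n) π)
  simp [h, Fintype.card_perm]

theorem card_perm_prod (n : ℕ) :
    Fintype.card (Equiv.Perm (Fin n) × Equiv.Perm (Fin n)) = n.factorial * n.factorial := by
  simp [Fintype.card_perm]

theorem expFootrule_eq_s9 (n : ℕ) :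
    expFootrule n = (∑ π, permStat (distArray n) π) / n.factorial := by
  have h : (n.factorial : ℝ) ≠ 0 := by positivity
  rw [expFootrule, sum_footrule fun x ↦ x, card_perm_prod]
  push_cast
  rw [nsmul_eq_mul]
  field_simp

theorem varFootrule_eq (n : ℕ) :
    varFootrule n =
      (∑ π, (permStat (distArray n) π - expFootrule n) ^ 2) / n.factorial := by
  have h : (n.factorial : ℝ) ≠ 0 := by positivity
  rw [varFootrule, sum_footrule fun x ↦ (x - expFootrule n) ^ 2, card_perm_prod]
  push_cast
  rw [nsmul_eq_mul]
  field_simp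

theorem charFun_stdFootruleLaw (n : ℕ) (t : ℝ) :
    charFun (stdFootruleLaw n : Measure ℝ) t =
      (∑ π, Complex.exp (t * ((permStat (distArray n) π - expFootrule n) / √(varFootrule n) : ℝ) *
        Complex.I)) / n.factorial := by
  let _ : MeasurableSpace (Equiv.Perm (Fin n) × Equiv.Perm (Fin n)) := ⊤
  have h : (n.factorial : ℂ) ≠ 0 := by exact_mod_cast n.factorial_ne_zero
  rw [charFun_apply_real, stdFootruleLaw, ProbabilityMeasure.coe_mk,
    ← PMF.toMeasure_map _ _ (measurable_from_top), integral_map measurable_from_top.aemeasurable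
      (by fun_prop), PMF.integral_eq_sum]
  simp only [PMF.uniformOfFintype_apply, card_perm_prod]
  rw [← Finset.smul_sum, sum_footrule fun x : ℝ ↦
    Complex.exp (t * ((x - expFootrule n) / √(varFootrule n) : ℝ) * Complex.I)]
  simp only [Complex.real_smul, nsmul_eq_mul]
  simp
  field_simp
  exact Finset.sum_congr rfl fun π _ ↦ by ring_nf

theorem abs_swapDiff_distArray_le {n : ℕ} (π : Equiv.Perm (Fin n)) (i j : Fin n) :
    |swapDiff (distArray n) π i j| ≤ 2 * n := by
  have h (k l : Fin n) : 0 ≤ distArray n k l ∧ distArray n k l ≤ n := by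
    refine ⟨abs_nonneg _, abs_sub_le_of_nonneg_of_le ?_ ?_ ?_ ?_⟩ <;> simp [Fin.is_le']
  rw [abs_le]
  constructor <;> simp only [swapDiff] <;>
    linarith [h i (π i), h j (π j), h i (π j), h j (π i)]

/-- For `i ≠ j` the pair `(π i, π j)` takes each value `(k, l)` with `k ≠ l` with probability at
least `1 / n ^ 2`. -/
theorem factorial_mul_sum_le_sum_perm {n : ℕ} (h : Fin n → Fin n → ℝ) (hh : ∀ k l, 0 ≤ h k l)
    (hdiag : ∀ k, h k k = 0) {i j : Fin n} (hij : i ≠ j) :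
    n.factorial * ∑ k, ∑ l, h k l ≤ n ^ 2 * ∑ π : Equiv.Perm (Fin n), h (π i) (π j) := by
  have hle (k l : Fin n) : ∑ π : Equiv.Perm (Fin n), h (π k) (π l) ≤
      ∑ π : Equiv.Perm (Fin n), h (π i) (π j) := by
    rcases eq_or_ne k l with rfl | hkl
    · simpa [hdiag] using Finset.sum_nonneg fun π _ ↦ hh _ _
    · obtain ⟨σ, hσi, hσj⟩ := MulAction.is_two_pretransitive_iff.1
        (Equiv.Perm.isMultiplyPretransitive (Fin n) 2) hij hkl
      rw [← Equiv.sum_comp (Equiv.mulRight σ⁻¹)]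
      subst hσi hσj
      simp
  calc n.factorial * ∑ k, ∑ l, h k l
      = ∑ π : Equiv.Perm (Fin n), ∑ k, ∑ l, h (π k) (π l) := by
        have (π : Equiv.Perm (Fin n)) : ∑ k, ∑ l, h (π k) (π l) = ∑ k, ∑ l, h k l := by
          rw [← Equiv.sum_comp π fun k ↦ ∑ l, h k l]
          exact Finset.sum_congr rfl fun k _ ↦ Equiv.sum_comp π (h (π k))
        simp [this, Fintype.card_perm]
    _ = ∑ k, ∑ l, ∑ π : Equiv.Perm (Fin n), h (π k) (π l) := by
        rw [Finset.sum_comm]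
        exact Finset.sum_congr rfl fun k _ ↦ Finset.sum_comm
    _ ≤ ∑ _k : Fin n, ∑ _l : Fin n, ∑ π : Equiv.Perm (Fin n), h (π i) (π j) :=
        Finset.sum_le_sum fun k _ ↦ Finset.sum_le_sum fun l _ ↦ hle k l
    _ = _ := by
        simp
        ring

theorem card_mul_card_mul_le_sum {α : Type*} [Fintype α] (s t : Finset α) (f : α → α → ℝ) (c : ℝ)
    (hf : ∀ i j, 0 ≤ f i j) (hc : ∀ i ∈ s, ∀ j ∈ t, c ≤ f i j) :
    s.card * (t.card * c) ≤ ∑ i, ∑ j, f i j := by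
  calc s.card * (t.card * c) = ∑ _i ∈ s, ∑ _j ∈ t, c := by simp
    _ ≤ ∑ i ∈ s, ∑ j ∈ t, f i j :=
        Finset.sum_le_sum fun i hi ↦ Finset.sum_le_sum fun j hj ↦ hc i hi j hj
    _ ≤ ∑ i ∈ s, ∑ j, f i j := Finset.sum_le_sum fun i _ ↦
        Finset.sum_le_sum_of_subset_of_nonneg t.subset_univ fun j _ _ ↦ hf i j
    _ ≤ ∑ i, ∑ j, f i j :=
        Finset.sum_le_sum_of_subset_of_nonneg s.subset_univ fun i _ _ ↦
          Finset.sum_nonneg fun j _ ↦ hf i j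

theorem permStat_sub_div {n : ℕ} (a : Fin n → Fin n → ℝ) (c s : ℝ) (π : Equiv.Perm (Fin n)) :
    permStat (fun i j ↦ (a i j - c) / s) π = (permStat a π - n * c) / s := by
  simp [permStat, ← Finset.sum_div]

theorem swapDiff_sub_div {n : ℕ} (a : Fin n → Fin n → ℝ) (c s : ℝ) (π : Equiv.Perm (Fin n))
    (i j : Fin n) :
    swapDiff (fun i j ↦ (a i j - c) / s) π i j = swapDiff a π i j / s := by
  simp only [swapDiff]
  ring

theorem sum_sub_div_eq_zero {n : ℕ} (hn : n ≠ 0) (a : Fin n → Fin n → ℝ) (s : ℝ) :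
    ∑ i, ∑ j, (a i j - (∑ i, ∑ j, a i j) / n ^ 2) / s = 0 := by
  have hn' : (n : ℝ) ≠ 0 := by exact_mod_cast hn
  simp only [← Finset.sum_div, Finset.sum_sub_distrib]
  simp
  field_simp
  simp

theorem expFootrule_eq_mul {n : ℕ} (hn : n ≠ 0) :
    expFootrule n = n * ((∑ i, ∑ j, distArray n i j) / n ^ 2) := by
  have hn' : (n : ℝ) ≠ 0 := by exact_mod_cast hn
  have h : (n.factorial : ℝ) ≠ 0 := by positivity
  rw [expFootrule_eq_s9, sum_permStat _ hn]
  field_simp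

theorem sum_sq_swapDiff_distArray {n : ℕ} (hn : n ≠ 0) :
    ∑ π, ∑ i, ∑ j, swapDiff (distArray n) π i j ^ 2 = 4 * n * (n.factorial * varFootrule n) := by
  have hn' : (n : ℝ) ≠ 0 := by exact_mod_cast hn
  have h : (n.factorial : ℝ) ≠ 0 := by positivity
  have h1 := sum_swapVar hn (sum_sub_div_eq_zero hn (distArray n) 1)
  simp only [swapVar, permStat_sub_div, swapDiff_sub_div, ← expFootrule_eq_mul hn] at h1
  simp only [div_one, ← Finset.sum_div] at h1
  rw [varFootrule_eq, ← h1]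
  field_simp

theorem pow_four_le_mul_varFootrule {n m : ℕ} (hm : 0 < m) (hmn : 4 * m ≤ n) :
    (m : ℝ) ^ 4 ≤ 16 * n * varFootrule n := by
  have hn : n ≠ 0 := by lia
  have hn0 : (0 : ℝ) < n := by exact_mod_cast Nat.pos_of_ne_zero hn
  have hmn' : 4 * (m : ℝ) ≤ n := by exact_mod_cast hmn
  let lo : Finset (Fin n) := Finset.univ.map (Fin.castLEEmb (by lia : m ≤ n))
  let hi : Finset (Fin n) := lo.map Fin.revPerm.toEmbedding
  have hlo (i) (h : i ∈ lo) : (i : ℝ) ≤ m := by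
    obtain ⟨x, -, rfl⟩ := Finset.mem_map.1 h
    exact_mod_cast x.2.le
  have hhi (i) (h : i ∈ hi) : (n : ℝ) ≤ m + i := by
    obtain ⟨x, hx, rfl⟩ := Finset.mem_map.1 h
    obtain ⟨y, -, rfl⟩ := Finset.mem_map.1 hx
    have : n ≤ m + (n - (y + 1)) := by lia
    simp only [Equiv.toEmbedding_apply, Fin.revPerm_apply, Fin.val_rev, Fin.castLEEmb_apply,
      Fin.val_castLE]
    exact_mod_cast this
  have hcard : lo.card = m ∧ hi.card = m := by simp [lo, hi]
  have hpos (i : Fin n) : (0 : ℝ) ≤ i ∧ (i : ℝ) ≤ n :=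
    ⟨Nat.cast_nonneg _, by exact_mod_cast i.2.le⟩
  let h (i j k l : Fin n) : ℝ :=
    (distArray n i k + distArray n j l - distArray n i l - distArray n j k) ^ 2
  have hlower (i) (hi' : i ∈ lo) (j) (hj : j ∈ hi) (k) (hk : k ∈ lo) (l) (hl : l ∈ hi) :
      (n / 2 : ℝ) ^ 2 ≤ h i j k l := by
    have hik : distArray n i k ≤ m :=
      abs_sub_le_of_nonneg_of_le (hpos i).1 (hlo i hi') (hpos k).1 (hlo k hk)
    have hjl : distArray n j l ≤ m := by
      rw [distArray, abs_le]
      constructor <;> linarith [hpos j, hpos l, hhi j hj, hhi l hl]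
    have hil : (n - 2 * m : ℝ) ≤ distArray n i l := by
      rw [distArray, abs_sub_comm]
      exact le_trans (by linarith [hlo i hi', hhi l hl]) (le_abs_self _)
    have hjk : (n - 2 * m : ℝ) ≤ distArray n j k :=
      le_trans (by linarith [hlo k hk, hhi j hj]) (le_abs_self _)
    refine sq_le_sq.2 ?_
    rw [abs_of_pos (by positivity)]
    exact le_trans (by linarith) (neg_le_abs _)
  have hpair (i) (hi' : i ∈ lo) (j) (hj : j ∈ hi) :
      n.factorial * (m * (m * (n / 2 : ℝ) ^ 2)) ≤
        ∑ π, (n : ℝ) ^ 2 * swapDiff (distArray n) π i j ^ 2 := by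
    have hij : i ≠ j := by
      rintro rfl
      have hm' : (0 : ℝ) < m := by exact_mod_cast hm
      linarith [hlo i hi', hhi i hj]
    rw [← Finset.mul_sum]
    refine le_trans ?_ (factorial_mul_sum_le_sum_perm (h i j) (fun k l ↦ sq_nonneg _)
      (fun k ↦ by simp only [h]; ring) hij)
    gcongr
    simpa only [hcard] using card_mul_card_mul_le_sum lo hi (h i j) ((n / 2 : ℝ) ^ 2)
      (fun k l ↦ sq_nonneg _) (hlower i hi' j hj)
  have htotal := card_mul_card_mul_le_sum lo hi
    (fun i j ↦ ∑ π, (n : ℝ) ^ 2 * swapDiff (distArray n) π i j ^ 2) _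
    (fun i j ↦ by positivity) hpair
  have hswap : ∑ i, ∑ j, ∑ π, (n : ℝ) ^ 2 * swapDiff (distArray n) π i j ^ 2 =
      n ^ 2 * (4 * n * (n.factorial * varFootrule n)) := by
    rw [← sum_sq_swapDiff_distArray hn]
    simp only [Finset.mul_sum]
    exact (Finset.sum_comm.trans (Finset.sum_congr rfl fun i _ ↦ Finset.sum_comm)).symm
  rw [hswap, hcard.1, hcard.2] at htotal
  have hfac : (0 : ℝ) < n.factorial * n ^ 2 / 4 := by positivity
  refine le_of_mul_le_mul_left ?_ hfac
  linarith

theorem norm_charFun_stdFootruleLaw_sub_le {n : ℕ} (hn : 4 ≤ n) (t : ℝ) :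
    ‖charFun (stdFootruleLaw n : Measure ℝ) t - Complex.exp (-(t ^ 2 / 2))‖ ≤
      (512 * t ^ 2 + 262144 * |t|) * |t| / √n := by
  have hn0 : n ≠ 0 := by lia
  have hn' : (0 : ℝ) < n := by exact_mod_cast Nat.pos_of_ne_zero hn0
  have hcube : (n : ℝ) ^ 3 ≤ 65536 * varFootrule n := by
    have h := pow_four_le_mul_varFootrule (n := n) (m := n / 4) (by lia) (by lia)
    have hle : (n : ℝ) ≤ 8 * (n / 4 : ℕ) := by exact_mod_cast (by lia : n ≤ 8 * (n / 4))
    have h4 : (n : ℝ) ^ 4 ≤ (8 * (n / 4 : ℕ)) ^ 4 := by gcongr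
    refine le_of_mul_le_mul_left ?_ hn'
    linarith
  have hvar : 0 < varFootrule n := by
    have : (0 : ℝ) < n ^ 3 := by positivity
    linarith
  set s := √(varFootrule n) with hs
  have hs0 : 0 < s := Real.sqrt_pos.2 hvar
  have hs2 : s ^ 2 = varFootrule n := Real.sq_sqrt hvar.le
  set c : ℝ := (∑ i, ∑ j, distArray n i j) / n ^ 2
  let b : Fin n → Fin n → ℝ := fun i j ↦ (distArray n i j - c) / s
  have hb (π) : permStat b π = (permStat (distArray n) π - expFootrule n) / s := by
    rw [permStat_sub_div, expFootrule_eq_mul hn0]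
  have hδ (π i j) : |swapDiff b π i j| ≤ 2 * n / s := by
    rw [swapDiff_sub_div, abs_div, abs_of_pos hs0]
    gcongr
    exact abs_swapDiff_distArray_le π i j
  have hbvar : ∑ π, permStat b π ^ 2 = n.factorial := by
    have hfact : (n.factorial : ℝ) ≠ 0 := by positivity
    have h := varFootrule_eq n
    simp only [hb, div_pow, ← Finset.sum_div, hs2]
    rw [div_eq_iff hvar.ne', h]
    field_simp
  have hδle : 2 * n / s ≤ 512 / √n := by
    refine abs_le_of_sq_le_sq' ?_ (by positivity) |>.2
    rw [div_pow, div_pow, hs2, Real.sq_sqrt hn'.le, div_le_div_iff₀ hvar hn']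
    linarith
  have h := norm_sum_exp_permStat_sub_le hn0 (sum_sub_div_eq_zero hn0 (distArray n) s) hbvar hδ t
  rw [charFun_stdFootruleLaw]
  simp only [← hs, ← hb]
  refine h.trans ?_
  calc (t ^ 2 * (2 * n / s) + |t| * (√n * (2 * n / s) ^ 2)) * |t|
      ≤ (t ^ 2 * (512 / √n) + |t| * (√n * (512 / √n) ^ 2)) * |t| := by gcongr
    _ = _ := by
        have : √(n : ℝ) ≠ 0 := (Real.sqrt_pos.2 hn').ne'
        field_simp
        ring

end Footrule

/-- The footrule distance `D_n` between two independent uniformly random permutations of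
`{1,…,n}` is asymptotically normal: the laws of the standardized random variables
`(D_n − E[D_n]) / √(Var(D_n))` converge weakly, as `n → ∞`, to the standard Gaussian
measure on `ℝ` with mean `0` and variance `1`. -/
theorem footrule_asymptotically_normal :
    Tendsto (fun n : ℕ => stdFootruleLaw n) atTop
      (nhds (⟨gaussianReal 0 1, inferInstance⟩ : ProbabilityMeasure ℝ)) := by
  refine ProbabilityMeasure.tendsto_of_tendsto_charFun fun t ↦ ?_
  have hgauss : charFun (gaussianReal 0 1) t = Complex.exp (-(t ^ 2 / 2)) := by
    rw [charFun_gaussianReal]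
    simp
  rw [ProbabilityMeasure.coe_mk, hgauss, tendsto_iff_norm_sub_tendsto_zero]
  refine squeeze_zero' (Eventually.of_forall fun n ↦ norm_nonneg _)
    ((eventually_ge_atTop 4).mono fun n hn ↦ norm_charFun_stdFootruleLaw_sub_le hn t) ?_
  exact (Real.tendsto_sqrt_atTop.comp tendsto_natCast_atTop_atTop).const_div_atTop _
end
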